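/- There is a universal constant c > 0 such that: if K ⊂ ℝⁿ is a p-convex body with constant α, of volume 1 and in Löwner's minimal diameter position, and ρ := n^{−1/2} ∫_K |x| dx, then for every 1 ≤ s ≤ 2 and every t > 0, vol{x ∈ K : | |x|/√n − ρ | ≥ t} ≤ 4 exp(−2 c^p α n^{1 + p/2 − p/s} (t / T_s(X_K))^p). -/

import Mathlib

open MeasureTheory Real Set
open scoped ENNReal RealInnerProductSpace Pointwise

noncomputable section

namespace GM

abbrev E (n : ℕ) := EuclideanSpace ℝ (Fin n)

variable {n : ℕ}

/-- A centrally-symmetric convex body. -/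
def IsConvexBody (K : Set (E n)) : Prop :=
  IsCompact K ∧ Convex ℝ K ∧ (interior K).Nonempty ∧ K = -K

/-- The Euclidean unit sphere in `E n`. -/
def usphere (n : ℕ) : Set (E n) := Metric.sphere 0 1

/-- Haar probability measure on the unit sphere, realized as the normalized
`(n-1)`-dimensional Hausdorff measure restricted to the sphere. -/
def sphMeasure (n : ℕ) : Measure (E n) :=
  (μH[(n : ℝ) - 1] (usphere n))⁻¹ • (μH[(n : ℝ) - 1]).restrict (usphere n)

/-- The marginal density `g_θ(s) = vol_{n-1}(K ∩ {sθ + θ^⊥})`. -/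
def gdens (K : Set (E n)) (θ : E n) (s : ℝ) : ℝ :=
  (μH[(n : ℝ) - 1] (K ∩ {x : E n | ⟪x, θ⟫ = s})).toReal

/-- The centered Gaussian density with variance `ρ²`. -/
def gauss (ρ s : ℝ) : ℝ :=
  (Real.sqrt (2 * π) * ρ)⁻¹ * Real.exp (-(s ^ 2) / (2 * ρ ^ 2))

/-- Kolmogorov-type distance between even densities. -/
def dKol (f₁ f₂ : ℝ → ℝ) : ℝ :=
  sSup {d | ∃ t > (0 : ℝ), d = |(∫ s in (-t)..t, f₁ s) - ∫ s in (-t)..t, f₂ s|}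

/-- Linnik-type distance between densities. -/
def dLin (T : ℝ) (f₁ f₂ : ℝ → ℝ) : ℝ :=
  sSup {d | ∃ s : ℝ, 0 ≤ s ∧ s ≤ T ∧ d = |f₁ s / f₂ s - 1|}

/-- `ρ_θ = (∫_K ⟨x,θ⟩² dx)^{1/2}`. -/
def rhoDir (K : Set (E n)) (θ : E n) : ℝ :=
  Real.sqrt (∫ x in K, ⟪x, θ⟫ ^ 2)

def rhoMax (K : Set (E n)) : ℝ := sSup (rhoDir K '' usphere n)

def rhoAvg (K : Set (E n)) : ℝ := ∫ θ, rhoDir K θ ∂(sphMeasure n)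

/-- `C_iso(K) = ρ_max / ρ_avg`. -/
def Ciso (K : Set (E n)) : ℝ := rhoMax K / rhoAvg K

/-- Concentration hypothesis (⋆) with parameters `(ρ, A, B, ν, τ)`. -/
def ConcHyp (K : Set (E n)) (ρ A B ν τ : ℝ) : Prop :=
  ∀ t : ℝ, 0 ≤ t → t ≤ 1 →
    volume {x : E n | x ∈ K ∧ t * ρ ≤ |‖x‖ / Real.sqrt n - ρ|} ≤
      ENNReal.ofReal (A * Real.exp (-B * (n : ℝ) ^ ν * t ^ τ))

/-- The modulus of convexity of `K` (w.r.t. the gauge norm of `K`). -/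
def modConv (K : Set (E n)) (ε : ℝ) : ℝ :=
  sInf {d | ∃ x y : E n, gauge K x ≤ 1 ∧ gauge K y ≤ 1 ∧ ε ≤ gauge K (x - y) ∧
    d = 1 - gauge K ((2⁻¹ : ℝ) • (x + y))}

/-- `K` is a `p`-convex body with constant `α`. -/
def IsPConvexBody (K : Set (E n)) (p α : ℝ) : Prop :=
  IsConvexBody K ∧ ∀ ε : ℝ, 0 < ε → ε ≤ 2 → α * ε ^ p ≤ modConv K ε

/-- Löwner's minimal diameter position. -/
def IsLowner (K : Set (E n)) : Prop :=
  ∀ T : E n →ₗ[ℝ] E n, |LinearMap.det T| = 1 →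
    Metric.diam K ≤ Metric.diam (T '' K)

/-- The type-`s` constant of `X_K = (ℝⁿ, ‖·‖_K)`. -/
def typeConst (K : Set (E n)) (s : ℝ) : ℝ :=
  sInf {T : ℝ | 0 < T ∧ ∀ m : ℕ, ∀ x : Fin m → E n,
    Real.sqrt (((2 : ℝ) ^ m)⁻¹ * ∑ ε : Fin m → Bool,
      gauge K (∑ i, (if ε i then (1 : ℝ) else -1) • x i) ^ 2) ≤
      T * (∑ i, gauge K (x i) ^ s) ^ (1 / s)}

/-- `X_K` is (isometric to) a subspace of a quotient of `L_p([0,1])`: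
there is a closed submodule `N` of `L_p([0,1])` and a linear isometric embedding of
`(ℝⁿ, ‖·‖_K)` into the quotient `L_p([0,1]) ⧸ N` (with the quotient norm). -/
def IsSubspaceOfQuotientOfLp (K : Set (E n)) (p : ℝ) (hp : 1 ≤ p) : Prop :=
  letI : Fact ((1 : ℝ≥0∞) ≤ ENNReal.ofReal p) := ⟨ENNReal.one_le_ofReal.mpr hp⟩
  ∃ N : Submodule ℝ (MeasureTheory.Lp ℝ (ENNReal.ofReal p) (volume.restrict (Icc (0 : ℝ) 1))),
    IsClosed (N : Set (MeasureTheory.Lp ℝ (ENNReal.ofReal p) (volume.restrict (Icc (0 : ℝ) 1)))) ∧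
    ∃ J : E n →ₗ[ℝ]
      (MeasureTheory.Lp ℝ (ENNReal.ofReal p) (volume.restrict (Icc (0 : ℝ) 1)) ⧸ N),
      ∀ x : E n, gauge K x = ‖J x‖

/-- `K` is isotropic with isotropic constant `L`. -/
def IsIsotropic (K : Set (E n)) (L : ℝ) : Prop :=
  volume K = 1 ∧ ∀ θ : E n, ‖θ‖ = 1 → (∫ x in K, ⟪x, θ⟫ ^ 2) = L ^ 2

/-- Entropy of `g` over `K`. -/
def entK (K : Set (E n)) (g : E n → ℝ) : ℝ :=
  (∫ x in K, g x * Real.log (g x)) - (∫ x in K, g x) * Real.log (∫ x in K, g x)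

/-- `Var^q_K(f) = ∫_K |f - ∫_K f|^q`. -/
def varq (K : Set (E n)) (q : ℝ) (f : E n → ℝ) : ℝ :=
  ∫ x in K, |f x - ∫ y in K, f y| ^ q

/-- The dual gauge `‖y‖_K^* = sup_{x ∈ K} ⟨x,y⟩`. -/
def dualGauge (K : Set (E n)) (y : E n) : ℝ :=
  sSup ((fun x : E n => ⟪x, y⟫) '' K)

/-- Half the mean width `M*(K)`. -/
def Mstar (K : Set (E n)) : ℝ := ∫ θ, dualGauge K θ ∂(sphMeasure n)

/-- Minimal mean-width position. -/
def IsMinMeanWidth (K : Set (E n)) : Prop :=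
  ∀ T : E n →ₗ[ℝ] E n, |LinearMap.det T| = 1 → Mstar K ≤ Mstar (T '' K)

/-- Positive definite symmetric linear map. -/
def IsPosDef (T : E n →ₗ[ℝ] E n) : Prop :=
  LinearMap.IsSymmetric T ∧ ∀ x : E n, x ≠ 0 → 0 < ⟪T x, x⟫

/-- Operator norm (w.r.t. the Euclidean norm). -/
def opNorm (T : E n →ₗ[ℝ] E n) : ℝ := ‖LinearMap.toContinuousLinearMap T‖

lemma ennreal_mul_le_sq {u v w : ℝ≥0∞} (h : u + v ≤ 2 * w) : u * v ≤ w ^ 2 := by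
  by_cases hw : w = ⊤
  · subst hw; simp
  have h2 : 2 * w ≠ ⊤ := ENNReal.mul_ne_top (by simp) hw
  have hu : u ≠ ⊤ := ne_top_of_le_ne_top h2 (le_trans le_self_add h)
  have hv : v ≠ ⊤ := ne_top_of_le_ne_top h2 (le_trans le_add_self h)
  lift u to NNReal using hu
  lift v to NNReal using hv
  lift w to NNReal using hw
  norm_cast at h ⊢
  rw [← NNReal.coe_le_coe] at h ⊢
  push_cast at h ⊢
  have := u.coe_nonneg
  have := v.coe_nonneg
  nlinarith [sq_nonneg ((u : ℝ) - v)]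

lemma measure_add_le_of_compact {A : Set ℝ} (hA : MeasurableSet A) (hne : A.Nonempty)
    {c d : ℝ≥0∞}
    (h : ∀ K ⊆ A, IsCompact K → K.Nonempty → volume K + d ≤ c) : volume A + d ≤ c := by
  obtain ⟨a, ha⟩ := hne
  have hd : d ≤ c := le_trans le_add_self
    (h {a} (by simpa using ha) isCompact_singleton (by simp))
  by_cases hdt : d = ⊤
  · subst hdt; simp at hd; simp [hd]
  have : volume A ≤ c - d := by
    apply le_of_forall_lt
    intro r hr
    obtain ⟨K, hKA, hK, hrK⟩ := hA.exists_lt_isCompact hr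
    refine lt_of_lt_of_le hrK ?_
    apply ENNReal.le_sub_of_add_le_right hdt
    refine le_trans ?_ (h (K ∪ {a}) (by simp [insert_subset_iff, ha, hKA])
      (hK.union isCompact_singleton) (by simp))
    gcongr
    exact subset_union_left
  exact add_le_of_le_tsub_right_of_le hd this

lemma bm1_image (A : Set ℝ) (b : ℝ) :
    volume ((fun x => (x + b) / 2) '' A) = volume A / 2 := by
  have : (fun x => (x + b) / 2) '' A = (2⁻¹ : ℝ) • ((fun x => x + b) '' A) := by
    ext z
    simp only [Set.mem_image, Set.mem_smul_set]
    constructor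
    · rintro ⟨x, hx, rfl⟩
      exact ⟨x + b, ⟨x, hx, rfl⟩, by simp; ring⟩
    · rintro ⟨_, ⟨x, hx, rfl⟩, rfl⟩
      exact ⟨x, hx, by simp; ring⟩
  rw [this, Measure.addHaar_smul, Set.image_add_right, measure_preimage_add_right]
  simp
  rw [ENNReal.div_eq_inv_mul]

lemma bm1 {A B C : Set ℝ} (hA : MeasurableSet A) (hB : MeasurableSet B)
    (hAn : A.Nonempty) (hBn : B.Nonempty)
    (hC : ∀ x ∈ A, ∀ y ∈ B, (x + y) / 2 ∈ C) : volume A + volume B ≤ 2 * volume C := by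
  apply measure_add_le_of_compact hA hAn
  intro K hKA hK hKn
  rw [add_comm]
  apply measure_add_le_of_compact hB hBn
  intro L hLB hL hLn
  obtain ⟨a, haK, ha⟩ := hK.exists_isGreatest hKn
  obtain ⟨b, hbL, hb⟩ := hL.exists_isLeast hLn
  have h1 := bm1_image K b
  have h2 := bm1_image L a
  have hdis : AEDisjoint volume ((fun x => (x + b) / 2) '' K) ((fun x => (x + a) / 2) '' L) := by
    unfold AEDisjoint
    refine measure_mono_null (t := {(a + b) / 2}) ?_ (by simp)
    rintro z ⟨⟨x, hx, rfl⟩, ⟨y, hy, hxy⟩⟩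
    have := ha hx
    have := hb hy
    simp only [mem_singleton_iff]
    simp only at hxy
    linarith
  have hm : NullMeasurableSet ((fun x => (x + a) / 2) '' L) volume := by
    apply MeasurableSet.nullMeasurableSet
    apply IsCompact.measurableSet
    apply hL.image
    fun_prop
  have h3 := measure_union₀ hm hdis
  have h4 : volume (((fun x => (x + b) / 2) '' K) ∪ ((fun x => (x + a) / 2) '' L)) ≤ volume C := by
    apply measure_mono
    rintro z (⟨x, hx, rfl⟩ | ⟨x, hx, rfl⟩)
    · exact hC x (hKA hx) b (hLB hbL)
    · simp only [add_comm x a]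
      exact hC a (hKA haK) x (hLB hx)
  rw [h3, h1, h2] at h4
  calc volume L + volume K = 2 * (volume K / 2 + volume L / 2) := by
        rw [mul_add, ENNReal.mul_div_cancel (by simp) (by simp),
          ENNReal.mul_div_cancel (by simp) (by simp), add_comm]
    _ ≤ _ := by gcongr

lemma pl1_norm {F G H : ℝ → ℝ} (hF : Measurable F) (hG : Measurable G) (hH : Measurable H)
    (hF0 : ∀ x, 0 ≤ F x) (hG0 : ∀ x, 0 ≤ G x) (hH0 : ∀ x, 0 ≤ H x)
    (hF1 : ∀ x, F x ≤ 1) (hG1 : ∀ x, G x ≤ 1)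
    (hFs : ∀ t < 1, ∃ x, t < F x) (hGs : ∀ t < 1, ∃ x, t < G x)
    (h : ∀ x y, F x * G y ≤ H ((x + y) / 2) ^ 2) :
    (∫⁻ x, ENNReal.ofReal (F x)) + (∫⁻ x, ENNReal.ofReal (G x)) ≤
      2 * ∫⁻ x, ENNReal.ofReal (H x) := by
  rw [lintegral_eq_lintegral_meas_lt _ (ae_of_all _ hF0) hF.aemeasurable,
    lintegral_eq_lintegral_meas_lt _ (ae_of_all _ hG0) hG.aemeasurable,
    lintegral_eq_lintegral_meas_lt _ (ae_of_all _ hH0) hH.aemeasurable]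
  have hanti : ∀ F : ℝ → ℝ, Measurable fun t => volume {a | t < F a} := by
    intro F
    apply Antitone.measurable
    intro s t hst
    apply measure_mono
    intro a ha
    exact lt_of_le_of_lt hst ha
  rw [← lintegral_add_left (hanti F), ← lintegral_const_mul _ (hanti H)]
  apply setLIntegral_mono' measurableSet_Ioi
  intro t ht
  rw [mem_Ioi] at ht
  by_cases ht1 : t < 1
  · apply bm1 (measurableSet_lt measurable_const hF) (measurableSet_lt measurable_const hG)
      (hFs t ht1) (hGs t ht1)
    intro x hx y hy
    simp only [mem_ofPred_eq] at hx hy ⊢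
    have := h x y
    have h2 : t * t < F x * G y := mul_lt_mul'' hx hy ht.le ht.le
    apply lt_of_pow_lt_pow_left₀ 2 (hH0 _)
    linarith [sq t]
  · have e1 : {a | t < F a} = ∅ := by
      ext a; simp; linarith [hF1 a]
    have e2 : {a | t < G a} = ∅ := by
      ext a; simp; linarith [hG1 a]
    simp [e1, e2]

lemma pl1_bdd {F G H : ℝ → ℝ} (hF : Measurable F) (hG : Measurable G) (hH : Measurable H)
    (hF0 : ∀ x, 0 ≤ F x) (hG0 : ∀ x, 0 ≤ G x) (hH0 : ∀ x, 0 ≤ H x)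
    {N : ℝ} (hFN : ∀ x, F x ≤ N) (hGN : ∀ x, G x ≤ N)
    (h : ∀ x y, F x * G y ≤ H ((x + y) / 2) ^ 2) :
    (∫⁻ x, ENNReal.ofReal (F x)) * (∫⁻ x, ENNReal.ofReal (G x)) ≤
      (∫⁻ x, ENNReal.ofReal (H x)) ^ 2 := by
  have bF : BddAbove (range F) := ⟨N, by rintro _ ⟨x, rfl⟩; exact hFN x⟩
  have bG : BddAbove (range G) := ⟨N, by rintro _ ⟨x, rfl⟩; exact hGN x⟩
  set a := ⨆ x, F x with ha
  set b := ⨆ x, G x with hb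
  have hFa : ∀ x, F x ≤ a := fun x => le_ciSup bF x
  have hGb : ∀ x, G x ≤ b := fun x => le_ciSup bG x
  have ha0 : 0 ≤ a := le_trans (hF0 0) (hFa 0)
  have hb0 : 0 ≤ b := le_trans (hG0 0) (hGb 0)
  rcases ha0.eq_or_lt with ha0 | ha0
  · have : ∀ x, F x = 0 := fun x => le_antisymm (by rw [ha0]; exact hFa x) (hF0 x)
    simp [this]
  rcases hb0.eq_or_lt with hb0 | hb0
  · have : ∀ x, G x = 0 := fun x => le_antisymm (by rw [hb0]; exact hGb x) (hG0 x)
    simp [this]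
  have hab : 0 < a * b := mul_pos ha0 hb0
  have hs : 0 < √(a * b) := Real.sqrt_pos.2 hab
  have key := pl1_norm (F := fun x => F x / a) (G := fun x => G x / b)
    (H := fun x => H x / √(a * b)) (hF.div_const _) (hG.div_const _) (hH.div_const _)
    (fun x => div_nonneg (hF0 x) ha0.le) (fun x => div_nonneg (hG0 x) hb0.le)
    (fun x => div_nonneg (hH0 x) hs.le)
    (fun x => (div_le_one ha0).2 (hFa x)) (fun x => (div_le_one hb0).2 (hGb x))
    (by
      intro t ht
      have : t * a < ⨆ x, F x := by nlinarith
      obtain ⟨x, hx⟩ := exists_lt_of_lt_ciSup this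
      exact ⟨x, by rw [lt_div_iff₀ ha0]; exact hx⟩)
    (by
      intro t ht
      have : t * b < ⨆ x, G x := by nlinarith
      obtain ⟨x, hx⟩ := exists_lt_of_lt_ciSup this
      exact ⟨x, by rw [lt_div_iff₀ hb0]; exact hx⟩)
    (by
      intro x y
      rw [div_pow, Real.sq_sqrt hab.le, div_mul_div_comm]
      gcongr
      exact h x y)
  have key2 := ennreal_mul_le_sq key
  have sc : ∀ (F : ℝ → ℝ) (a : ℝ), Measurable F → 0 < a → (∫⁻ x, ENNReal.ofReal (F x)) =
      ENNReal.ofReal a * ∫⁻ x, ENNReal.ofReal (F x / a) := by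
    intro F a hF ha
    rw [← lintegral_const_mul _ (hF.div_const _).ennreal_ofReal]
    congr 1
    ext x
    rw [← ENNReal.ofReal_mul ha.le]
    congr 1
    field_simp
  rw [sc F a hF ha0, sc G b hG hb0, sc H _ hH hs, mul_pow, ← ENNReal.ofReal_pow hs.le,
    Real.sq_sqrt hab.le, ENNReal.ofReal_mul ha0.le, mul_mul_mul_comm]
  gcongr

/-- Midpoint Prekopa-Leindler property of a measure. -/
def PLProp {α : Type*} [MeasurableSpace α] [AddCommGroup α] [Module ℝ α] (μ : Measure α) : Prop :=
  ∀ f g h : α → ℝ≥0∞, Measurable f → Measurable g → Measurable h →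
    (∀ x y, f x * g y ≤ h ((2⁻¹ : ℝ) • (x + y)) ^ 2) →
    (∫⁻ x, f x ∂μ) * (∫⁻ x, g x ∂μ) ≤ (∫⁻ x, h x ∂μ) ^ 2

lemma pl_real : PLProp (volume : Measure ℝ) := by
  intro f g h hf hg hh hfg
  have step : ∀ N : ℕ, (∫⁻ x, min (f x) N) * (∫⁻ x, min (g x) N) ≤ (∫⁻ x, h x) ^ 2 := by
    intro N
    have hN : ∀ (f : ℝ → ℝ≥0∞) x, min (f x) N ≠ ⊤ := fun f x =>
      ne_top_of_le_ne_top (ENNReal.natCast_ne_top N) (min_le_right _ _)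
    have e : ∀ (f : ℝ → ℝ≥0∞) x, min (f x) N = ENNReal.ofReal (min (f x) N).toReal := fun f x =>
      (ENNReal.ofReal_toReal (hN f x)).symm
    have hb : ∀ (f : ℝ → ℝ≥0∞) x, (min (f x) N).toReal ≤ N := fun f x => by
      have := ENNReal.toReal_mono (ENNReal.natCast_ne_top N) (min_le_right (f x) (N : ℝ≥0∞))
      simpa using this
    have key := pl1_bdd (F := fun x => (min (f x) N).toReal) (G := fun x => (min (g x) N).toReal)
      (H := fun x => (min (h x) N).toReal) (hf.min measurable_const).ennreal_toReal
      (hg.min measurable_const).ennreal_toReal (hh.min measurable_const).ennreal_toReal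
      (fun x => ENNReal.toReal_nonneg) (fun x => ENNReal.toReal_nonneg)
      (fun x => ENNReal.toReal_nonneg) (hb f) (hb g) (by
        intro x y
        rw [← ENNReal.toReal_mul, ← ENNReal.toReal_pow]
        apply ENNReal.toReal_mono (ENNReal.pow_ne_top (hN h _))
        rcases le_total (h ((x + y) / 2)) N with h1 | h1
        · rw [min_eq_left h1]
          refine le_trans (mul_le_mul' (min_le_left _ _) (min_le_left _ _)) ?_
          have e2 : (x + y) / 2 = (2⁻¹ : ℝ) • (x + y) := by rw [smul_eq_mul]; ring
          rw [e2]
          exact hfg x y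
        · rw [min_eq_right h1, sq]
          exact mul_le_mul' (min_le_right _ _) (min_le_right _ _))
    simp only [← e] at key
    refine key.trans ?_
    gcongr
    exact min_le_left _ _
  have conv : ∀ f : ℝ → ℝ≥0∞, Measurable f → (∫⁻ x, f x) = ⨆ N : ℕ, ∫⁻ x, min (f x) N := by
    intro f hf
    rw [← lintegral_iSup]
    · congr 1
      ext x
      rw [← inf_iSup_eq, ENNReal.iSup_natCast]
      simp
    · exact fun N => hf.min measurable_const
    · intro N M hNM x
      simp only
      gcongr
  have mono : ∀ (f : ℝ → ℝ≥0∞) (N M : ℕ), N ≤ M →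
      (∫⁻ x, min (f x) N) ≤ ∫⁻ x, min (f x) M := by
    intro f N M hNM
    gcongr
  rw [conv f hf, conv g hg]
  simp_rw [ENNReal.iSup_mul, ENNReal.mul_iSup]
  refine iSup_le fun N => iSup_le fun M => ?_
  exact le_trans (mul_le_mul' (mono f _ _ (le_max_left N M)) (mono g _ _ (le_max_right N M)))
    (step _)

lemma PLProp.prod {α β : Type*} [MeasurableSpace α] [AddCommGroup α] [Module ℝ α]
    [MeasurableSpace β] [AddCommGroup β] [Module ℝ β] {μ : Measure α} {ν : Measure β}
    [SFinite μ] [SFinite ν] (hμ : PLProp μ) (hν : PLProp ν) : PLProp (μ.prod ν) := by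
  intro f g h hf hg hh hfg
  rw [lintegral_prod _ hf.aemeasurable, lintegral_prod _ hg.aemeasurable,
    lintegral_prod _ hh.aemeasurable]
  apply hμ _ _ _ hf.lintegral_prod_right' hg.lintegral_prod_right' hh.lintegral_prod_right'
  intro x y
  apply hν _ _ _ (hf.comp measurable_prodMk_left) (hg.comp measurable_prodMk_left)
    (hh.comp measurable_prodMk_left)
  intro u v
  exact hfg (x, u) (y, v)

lemma PLProp.map {α β : Type*} [MeasurableSpace α] [AddCommGroup α] [Module ℝ α]
    [MeasurableSpace β] [AddCommGroup β] [Module ℝ β] {μ : Measure α} {ν : Measure β}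
    (hμ : PLProp μ) (φ : α → β) (hφ : MeasurePreserving φ μ ν)
    (hlin : ∀ x y, φ ((2⁻¹ : ℝ) • (x + y)) = (2⁻¹ : ℝ) • (φ x + φ y)) : PLProp ν := by
  intro f g h hf hg hh hfg
  rw [← hφ.lintegral_comp hf, ← hφ.lintegral_comp hg, ← hφ.lintegral_comp hh]
  apply hμ _ _ _ (hf.comp hφ.measurable) (hg.comp hφ.measurable) (hh.comp hφ.measurable)
  intro x y
  simp only [Function.comp, hlin]
  exact hfg _ _

lemma pl_pi (n : ℕ) : PLProp (volume : Measure (Fin n → ℝ)) := by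
  induction n with
  | zero =>
    intro f g h hf hg hh hfg
    rw [lintegral_unique, lintegral_unique, lintegral_unique]
    have : (volume : Measure (Fin 0 → ℝ)) univ = 1 := by simp [volume_pi]
    rw [this]
    simp only [mul_one]
    convert hfg default default
  | succ n ih =>
    have := (volume_preserving_piFinSuccAbove (fun _ : Fin (n + 1) => ℝ) 0).symm
    refine PLProp.map (pl_real.prod ih) _ this ?_
    intro x y
    ext i
    refine Fin.cases ?_ (fun i => ?_) i <;> simp [MeasurableEquiv.piFinSuccAbove] <;> ring

lemma pl_E (n : ℕ) : PLProp (volume : Measure (E n)) :=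
  PLProp.map (pl_pi n) _ (PiLp.volume_preserving_toLp (Fin n)) (by intro x y; simp)

lemma bm_E {A B C : Set (E n)} (hA : MeasurableSet A) (hB : MeasurableSet B)
    (hC : MeasurableSet C)
    (h : ∀ x ∈ A, ∀ y ∈ B, (2⁻¹ : ℝ) • (x + y) ∈ C) : volume A * volume B ≤ volume C ^ 2 := by
  have := pl_E n (A.indicator 1) (B.indicator 1) (C.indicator 1)
    (measurable_one.indicator hA) (measurable_one.indicator hB) (measurable_one.indicator hC) (by
      intro x y
      by_cases hx : x ∈ A
      · by_cases hy : y ∈ B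
        · simp [hx, hy, h x hx y hy, -smul_add]
        · simp [hy]
      · simp [hx])
  simpa [lintegral_indicator_one, hA, hB, hC] using this

lemma conc_upper {α : Type*} [MeasurableSpace α] (μ : Measure α) [IsProbabilityMeasure μ]
    {f : α → ℝ} (hf : Measurable f) (hfi : Integrable f μ) {L p : ℝ} (hL : 0 < L) (hp : 1 ≤ p)
    (h : ∀ a b, a < b → μ {x | f x ≤ a} * μ {x | b ≤ f x} ≤
      ENNReal.ofReal (Real.exp (-(L * (b - a)) ^ p)))
    {t : ℝ} (ht : 0 < t) :
    μ {x | (∫ y, f y ∂μ) + t ≤ f x} ≤ ENNReal.ofReal (2 * Real.exp (-(L * t / 40) ^ p)) := by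
  set m := ∫ y, f y ∂μ with hm
  by_cases hreg : L * t ≤ 24
  · have h1 : (L * t / 40) ^ p ≤ 0.6 := by
      have hx : L * t / 40 ≤ 0.6 := by linarith
      have hx0 : 0 < L * t / 40 := by positivity
      calc (L * t / 40) ^ p ≤ (L * t / 40) ^ (1 : ℝ) :=
            Real.rpow_le_rpow_of_exponent_ge hx0 (by linarith) hp
        _ ≤ 0.6 := by rwa [Real.rpow_one]
    have h2 : 1 ≤ 2 * Real.exp (-(L * t / 40) ^ p) := by
      have h3 : Real.exp (-Real.log 2) ≤ Real.exp (-(L * t / 40) ^ p) := by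
        apply Real.exp_le_exp.2
        have := Real.log_two_gt_d9
        linarith
      rw [Real.exp_neg, Real.exp_log (by norm_num)] at h3
      linarith
    calc _ ≤ (1 : ℝ≥0∞) := prob_le_one
      _ ≤ _ := by
        rw [← ENNReal.ofReal_one]
        exact ENNReal.ofReal_le_ofReal h2
  push Not at hreg
  -- tail comparison
  have tail : ∀ u, 0 ≤ u → Real.exp (-(L * u) ^ p) ≤ Real.exp (1 - L * u) := by
    intro u hu
    apply Real.exp_le_exp.2
    have h0 : 0 ≤ L * u := by positivity
    by_cases h1 : L * u ≤ 1
    · have := Real.rpow_nonneg h0 p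
      linarith
    · push Not at h1
      have := Real.rpow_le_rpow_of_exponent_le h1.le hp
      rw [Real.rpow_one] at this
      linarith
  have half : (1 / 2 : ℝ) ≤ (μ {x | f x ≤ m + t / 2}).toReal := by
    by_contra hcon
    push Not at hcon
    have hq : (1 / 2 : ℝ) ≤ (μ {x | m + t / 2 ≤ f x}).toReal := by
      have h1 : (1 : ℝ≥0∞) ≤ μ {x | f x ≤ m + t / 2} + μ {x | m + t / 2 ≤ f x} := by
        rw [← measure_univ (μ := μ)]
        refine le_trans (measure_mono ?_) (measure_union_le _ _)
        intro x _
        exact le_total (f x) (m + t / 2)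
      have h2 := ENNReal.toReal_mono
        (ENNReal.add_ne_top.2 ⟨measure_ne_top _ _, measure_ne_top _ _⟩) h1
      rw [ENNReal.toReal_add (measure_ne_top _ _) (measure_ne_top _ _)] at h2
      simp only [ENNReal.toReal_one] at h2
      linarith
    have hlow : ∀ u, 0 < u → μ {x | f x ≤ m - u} ≤
        ENNReal.ofReal (2 * Real.exp 1 * Real.exp (-L * u)) := by
      intro u hu
      have h1 := h (m - u) (m + t / 2) (by linarith)
      have h2 := ENNReal.toReal_mono ENNReal.ofReal_ne_top h1
      rw [ENNReal.toReal_mul, ENNReal.toReal_ofReal (Real.exp_pos _).le] at h2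
      rw [← ENNReal.ofReal_toReal (measure_ne_top μ {x | f x ≤ m - u})]
      apply ENNReal.ofReal_le_ofReal
      have h3 := tail (m + t / 2 - (m - u)) (by linarith)
      have h4 : Real.exp (1 - L * (m + t / 2 - (m - u))) ≤ Real.exp 1 * Real.exp (-L * u) := by
        rw [← Real.exp_add]
        apply Real.exp_le_exp.2
        nlinarith
      have h5 : 0 ≤ (μ {x | f x ≤ m - u}).toReal := ENNReal.toReal_nonneg
      nlinarith
    have hup : ∫ x, max (m - f x) 0 ∂μ ≤ 2 * Real.exp 1 / L := by
      have hnn : 0 ≤ᵐ[μ] fun x => max (m - f x) 0 := ae_of_all _ fun x => le_max_right _ _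
      have hmm : Measurable fun x => max (m - f x) 0 := by fun_prop
      rw [integral_eq_lintegral_of_nonneg_ae hnn hmm.aestronglyMeasurable]
      apply ENNReal.toReal_le_of_le_ofReal (by positivity)
      rw [lintegral_eq_lintegral_meas_lt _ hnn hmm.aemeasurable]
      calc _ ≤ ∫⁻ u in Ioi 0, ENNReal.ofReal (2 * Real.exp 1 * Real.exp (-L * u)) := by
            apply setLIntegral_mono' measurableSet_Ioi
            intro u hu
            refine le_trans (measure_mono ?_) (hlow u hu)
            intro x hx
            simp only [mem_ofPred_eq, lt_max_iff] at hx ⊢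
            rw [mem_Ioi] at hu
            rcases hx with hx | hx <;> linarith
        _ = _ := by
            rw [← ofReal_integral_eq_lintegral_ofReal]
            · congr 1
              rw [integral_const_mul, integral_exp_mul_Ioi (by linarith)]
              simp
              field_simp
            · exact (integrableOn_exp_mul_Ioi (by linarith) 0).const_mul _
            · exact ae_of_all _ fun u => by positivity
    have hfm : Integrable (fun x => f x - m) μ := hfi.sub (integrable_const _)
    have hfm' : Integrable (fun x => m - f x) μ := (integrable_const _).sub hfi
    have heq : ∫ x, max (f x - m) 0 ∂μ = ∫ x, max (m - f x) 0 ∂μ := by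
      have e1 : ∀ x, max (f x - m) 0 = max (m - f x) 0 + (f x - m) := by
        intro x
        rcases le_total (f x) m with hx | hx
        · rw [max_eq_right (by linarith), max_eq_left (by linarith)]; ring
        · rw [max_eq_left (by linarith), max_eq_right (by linarith)]; ring
      simp_rw [e1]
      rw [integral_add hfm'.pos_part hfm, integral_sub hfi (integrable_const _)]
      simp [← hm]
    have hmk := mul_meas_ge_le_integral_of_nonneg (μ := μ) (f := fun x => max (f x - m) 0)
      (ae_of_all _ fun x => le_max_right _ _) hfm.pos_part (t / 2)
    have hset : (μ {x | m + t / 2 ≤ f x}).toReal ≤ μ.real {x | t / 2 ≤ max (f x - m) 0} := by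
      apply ENNReal.toReal_mono (measure_ne_top _ _)
      apply measure_mono
      intro x hx
      simp only [mem_ofPred_eq, le_max_iff] at hx ⊢
      left; linarith
    rw [heq] at hmk
    have h6 : t / 4 ≤ 2 * Real.exp 1 / L := by nlinarith
    rw [le_div_iff₀ hL] at h6
    have := Real.exp_one_lt_d9
    nlinarith
  have h1 := h (m + t / 2) (m + t) (by linarith)
  have h2 := ENNReal.toReal_mono ENNReal.ofReal_ne_top h1
  rw [ENNReal.toReal_mul, ENNReal.toReal_ofReal (Real.exp_pos _).le] at h2
  rw [← ENNReal.ofReal_toReal (measure_ne_top μ {x | m + t ≤ f x})]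
  apply ENNReal.ofReal_le_ofReal
  have h3 : Real.exp (-(L * (m + t - (m + t / 2))) ^ p) ≤ Real.exp (-(L * t / 40) ^ p) := by
    apply Real.exp_le_exp.2
    apply neg_le_neg
    apply Real.rpow_le_rpow (by positivity) _ (by linarith)
    have : 0 < L * t := by positivity
    nlinarith
  have h5 : 0 ≤ (μ {x | m + t ≤ f x}).toReal := ENNReal.toReal_nonneg
  nlinarith

lemma conc_two {α : Type*} [MeasurableSpace α] (μ : Measure α) [IsProbabilityMeasure μ]
    {f : α → ℝ} (hf : Measurable f) (hfi : Integrable f μ) {L p : ℝ} (hL : 0 < L) (hp : 1 ≤ p)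
    (h : ∀ a b, a < b → μ {x | f x ≤ a} * μ {x | b ≤ f x} ≤
      ENNReal.ofReal (Real.exp (-(L * (b - a)) ^ p)))
    {t : ℝ} (ht : 0 < t) :
    μ {x | t ≤ |f x - ∫ y, f y ∂μ|} ≤ ENNReal.ofReal (4 * Real.exp (-(L * t / 40) ^ p)) := by
  have h1 := conc_upper μ hf hfi hL hp h ht
  have h2 := conc_upper μ (f := fun x => - f x) hf.neg hfi.neg hL hp (by
    intro a b hab
    have := h (-b) (-a) (by linarith)
    rw [mul_comm]
    have e1 : {x | -f x ≤ a} = {x | -a ≤ f x} := by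
      ext x; simp only [mem_ofPred_eq]; exact neg_le
    have e2 : {x | b ≤ -f x} = {x | f x ≤ -b} := by
      ext x; simp only [mem_ofPred_eq]; exact le_neg
    have e3 : -a - -b = b - a := by ring
    rw [e3] at this
    rw [e1, e2]
    exact this) ht
  rw [integral_neg] at h2
  calc _ ≤ μ ({x | (∫ y, f y ∂μ) + t ≤ f x} ∪ {x | -(∫ y, f y ∂μ) + t ≤ - f x}) := by
        apply measure_mono
        intro x hx
        simp only [mem_ofPred_eq, mem_union] at hx ⊢
        rcases le_abs.1 hx with hx | hx
        · left; linarith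
        · right; linarith
    _ ≤ _ := measure_union_le _ _
    _ ≤ _ := add_le_add h1 h2
    _ = _ := by
        rw [← ENNReal.ofReal_add (by positivity) (by positivity)]
        congr 1; ring

/-- Diagonal map in an orthonormal basis. -/
def diagMap (b : OrthonormalBasis (Fin n) ℝ (E n)) (d : Fin n → ℝ) : E n →ₗ[ℝ] E n :=
  Matrix.toLin b.toBasis b.toBasis (Matrix.diagonal d)

lemma diagMap_det (b : OrthonormalBasis (Fin n) ℝ (E n)) (d : Fin n → ℝ) :
    LinearMap.det (diagMap b d) = ∏ i, d i := by
  rw [diagMap, LinearMap.det_toLin, Matrix.det_diagonal]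

lemma diagMap_apply_basis (b : OrthonormalBasis (Fin n) ℝ (E n)) (d : Fin n → ℝ) (i : Fin n) :
    diagMap b d (b i) = d i • b i := by
  have := Matrix.toLin_self b.toBasis b.toBasis (Matrix.diagonal d) i
  rw [b.coe_toBasis] at this
  rw [diagMap, this, Finset.sum_eq_single i]
  · simp
  · intro j _ hj
    simp [Matrix.diagonal_apply_ne _ hj]
  · simp

lemma diagMap_apply (b : OrthonormalBasis (Fin n) ℝ (E n)) (d : Fin n → ℝ) (x : E n) :
    diagMap b d x = ∑ i, (d i * ⟪b i, x⟫) • b i := by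
  conv_lhs => rw [← b.sum_repr' x]
  rw [map_sum]
  congr 1
  ext1 i
  rw [map_smul, diagMap_apply_basis, smul_smul, mul_comm]

lemma onb_norm_sq (b : OrthonormalBasis (Fin n) ℝ (E n)) (x : E n) :
    ‖x‖ ^ 2 = ∑ i, ⟪b i, x⟫ ^ 2 := by
  rw [← b.sum_sq_norm_inner_right x]
  simp

lemma onb_inner_sum (b : OrthonormalBasis (Fin n) ℝ (E n)) (c : Fin n → ℝ) (i : Fin n) :
    ⟪b i, ∑ j, c j • b j⟫ = c i := by
  rw [b.orthonormal.inner_right_fintype]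

lemma onb_norm_sq_sum (b : OrthonormalBasis (Fin n) ℝ (E n)) (c : Fin n → ℝ) :
    ‖∑ j, c j • b j‖ ^ 2 = ∑ i, c i ^ 2 := by
  rw [onb_norm_sq b]
  simp_rw [onb_inner_sum]

lemma norm_le_half_diam {K : Set (E n)} (hK : IsConvexBody K) {x : E n} (hx : x ∈ K) :
    ‖x‖ ≤ Metric.diam K / 2 := by
  have hx' : -x ∈ K := by
    rw [hK.2.2.2]; simpa using hx
  have := Metric.dist_le_diam_of_mem hK.1.isBounded hx hx'
  rw [dist_eq_norm, sub_neg_eq_add, ← two_smul ℝ x, norm_smul] at this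
  simp at this
  linarith

lemma convexBody_nonempty {K : Set (E n)} (hK : IsConvexBody K) : K.Nonempty :=
  hK.2.2.1.mono interior_subset

lemma lowner_exists {K : Set (E n)} (hK : IsConvexBody K) (hL : IsLowner K)
    (T : E n →ₗ[ℝ] E n) (hT : |LinearMap.det T| = 1) :
    ∃ u ∈ K, Metric.diam K / 2 ≤ ‖T u‖ := by
  have hc : Continuous T := T.continuous_of_finiteDimensional
  obtain ⟨u, huK, hu⟩ := hK.1.exists_isMaxOn (convexBody_nonempty hK)
    (hc.norm.continuousOn (s := K))
  refine ⟨u, huK, ?_⟩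
  have h1 := hL T hT
  have h2 : Metric.diam (T '' K) ≤ 2 * ‖T u‖ := by
    apply Metric.diam_le_of_forall_dist_le (by positivity)
    rintro _ ⟨x, hx, rfl⟩ _ ⟨y, hy, rfl⟩
    rw [dist_eq_norm]
    have hx1 : ‖T x‖ ≤ ‖T u‖ := hu hx
    have hy1 : ‖T y‖ ≤ ‖T u‖ := hu hy
    linarith [norm_sub_le (T x) (T y)]
  linarith

lemma sum_ite_fin (k : ℕ) (hk : k < n) (A B : ℝ) :
    ∑ i : Fin n, (if (i : ℕ) < k then A else B) = k * A + (n - k) * B := by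
  rw [Fin.sum_univ_eq_sum_range (fun i => if i < k then A else B) n,
    ← Finset.sum_range_add_sum_Ico _ hk.le]
  rw [Finset.sum_congr rfl (g := fun _ => A), Finset.sum_congr (s₁ := Finset.Ico k n) rfl
    (g := fun _ => B)]
  · simp [Nat.cast_sub hk.le]
  · intro i hi
    rw [Finset.mem_Ico] at hi
    simp [hi.1]
  · intro i hi
    rw [Finset.mem_range] at hi
    simp [hi]

lemma dr_step {K : Set (E n)} (hK : IsConvexBody K) (hL : IsLowner K)
    (b : OrthonormalBasis (Fin n) ℝ (E n)) (k : ℕ) (hk : k < n) :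
    ∃ u ∈ K, (Metric.diam K / 4) ^ 2 * ((n - k : ℝ) / n) ≤
      ∑ i : Fin n, (if (i : ℕ) < k then 0 else ⟪b i, u⟫) ^ 2 := by
  have hn : (0 : ℝ) < n := by exact_mod_cast (by omega : 0 < n)
  set w : Fin n → ℝ := fun i => if (i : ℕ) < k then -((n - k : ℝ) / n) else (k : ℝ) / n with hw
  have hdet : |LinearMap.det (diagMap b fun i => Real.exp (w i))| = 1 := by
    rw [diagMap_det, ← Real.exp_sum, hw, sum_ite_fin k hk]
    have : (k : ℝ) * -((n - k : ℝ) / n) + (n - k) * (k / n) = 0 := by ring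
    rw [this]; simp
  obtain ⟨u, huK, hu⟩ := lowner_exists hK hL _ hdet
  refine ⟨u, huK, ?_⟩
  set R := Metric.diam K / 2 with hR
  have hR0 : 0 ≤ R := by have := Metric.diam_nonneg (s := K); positivity
  have hR4 : Metric.diam K / 4 = R / 2 := by rw [hR]; ring
  have huR : ‖u‖ ^ 2 ≤ R ^ 2 := by
    have := norm_le_half_diam hK huK
    gcongr
  have h1 : R ^ 2 ≤ ‖diagMap b (fun i => Real.exp (w i)) u‖ ^ 2 := by gcongr
  rw [diagMap_apply, onb_norm_sq_sum] at h1
  rw [onb_norm_sq b u] at huR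
  set a := ∑ i : Fin n, (if (i : ℕ) < k then 0 else ⟪b i, u⟫) ^ 2 with ha
  set c := ∑ i : Fin n, (if (i : ℕ) < k then ⟪b i, u⟫ else 0) ^ 2 with hc
  have e1 : ∑ i, ⟪b i, u⟫ ^ 2 = a + c := by
    rw [ha, hc, ← Finset.sum_add_distrib]
    congr 1; ext i; split_ifs <;> simp
  set q := (n - k : ℝ) / n with hq
  have hq0 : 0 ≤ q := by
    have : (k : ℝ) ≤ n := by exact_mod_cast hk.le
    apply div_nonneg <;> linarith
  have hkn : (k : ℝ) / n = 1 - q := by rw [hq]; field_simp; ring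
  have e2 : ∑ i, (Real.exp (w i) * ⟪b i, u⟫) ^ 2 =
      Real.exp (2 * (1 - q)) * a + Real.exp (-2 * q) * c := by
    rw [ha, hc, Finset.mul_sum, Finset.mul_sum, ← Finset.sum_add_distrib]
    congr 1; ext i
    simp only [hw]
    have s1 : Real.exp (2 * (1 - q)) = Real.exp (1 - q) ^ 2 := by
      rw [← Real.exp_nat_mul]; norm_num
    have s2 : Real.exp (-2 * q) = Real.exp (-q) ^ 2 := by
      rw [← Real.exp_nat_mul]; congr 1; push_cast; ring
    rw [hkn, s1, s2]
    split_ifs <;> ring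
  rw [e1] at huR
  rw [e2] at h1
  have e3 : Real.exp (2 * q) * (Real.exp (2 * (1 - q)) * a + Real.exp (-2 * q) * c) =
      Real.exp 2 * a + c := by
    rw [mul_add, ← mul_assoc, ← mul_assoc, ← Real.exp_add, ← Real.exp_add]
    have r1 : 2 * q + 2 * (1 - q) = 2 := by ring
    have r2 : 2 * q + -2 * q = 0 := by ring
    rw [r1, r2, Real.exp_zero, one_mul]
  have h2 : Real.exp (2 * q) * R ^ 2 ≤ Real.exp 2 * a + c := by
    rw [← e3]
    gcongr
  have h3 : (2 * q + 1) * R ^ 2 ≤ Real.exp (2 * q) * R ^ 2 := by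
    gcongr
    exact Real.add_one_le_exp _
  have h4 : Real.exp 2 ≤ 9 := by
    have : Real.exp 2 = Real.exp 1 ^ 2 := by rw [← Real.exp_nat_mul]; norm_num
    rw [this]
    have := Real.exp_one_lt_d9
    have := Real.exp_pos 1
    nlinarith
  have ha0 : 0 ≤ a := by rw [ha]; positivity
  rw [hR4]
  nlinarith

lemma dr_induct {K : Set (E n)} (hK : IsConvexBody K) (hL : IsLowner K)
    (hd : 0 < Metric.diam K) (k : ℕ) (hk : k ≤ n) :
    ∃ (b : OrthonormalBasis (Fin n) ℝ (E n)) (x : Fin n → E n), ∀ j : Fin n, (j : ℕ) < k →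
      x j ∈ K ∧ x j ∈ Submodule.span ℝ (b '' {i | i ≤ j}) ∧
      Metric.diam K / 4 * √((n - j : ℝ) / n) ≤ ⟪b j, x j⟫ := by
  induction k with
  | zero => exact ⟨EuclideanSpace.basisFun _ _, fun _ => 0, fun j hj => by omega⟩
  | succ k ih =>
    obtain ⟨b, x, hbx⟩ := ih (by omega)
    have hkn : k < n := by omega
    obtain ⟨u, huK, hu⟩ := dr_step hK hL b k hkn
    have hn : (0 : ℝ) < n := by exact_mod_cast (by omega : 0 < n)
    set κ : Fin n := ⟨k, hkn⟩ with hκ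
    set w : E n := ∑ i : Fin n, (if (i : ℕ) < k then 0 else ⟪b i, u⟫) • b i with hw
    rw [← onb_norm_sq_sum b] at hu
    have hbw : ∀ i, ⟪b i, w⟫ = if (i : ℕ) < k then 0 else ⟪b i, u⟫ := by
      intro i; rw [hw, onb_inner_sum]
    have hq : 0 < (n - k : ℝ) / n := by
      have : (k : ℝ) < n := by exact_mod_cast hkn
      apply div_pos <;> linarith
    have hwpos : 0 < ‖w‖ := by
      have : 0 < ‖w‖ ^ 2 := lt_of_lt_of_le (by positivity) hu
      by_contra h0
      have h1 : ‖w‖ = 0 := le_antisymm (not_lt.1 h0) (norm_nonneg w)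
      simp [h1] at this
    have hwle : Metric.diam K / 4 * √((n - k : ℝ) / n) ≤ ‖w‖ := by
      apply (sq_le_sq₀ (by positivity) hwpos.le).1
      rw [mul_pow, Real.sq_sqrt hq.le]
      exact hu
    have hwu : ⟪w, u⟫ = ‖w‖ ^ 2 := by
      rw [hw, sum_inner, onb_norm_sq_sum]
      congr 1; ext i
      rw [real_inner_smul_left]
      split_ifs <;> ring
    set v : Fin n → E n := Function.update b κ (‖w‖⁻¹ • w) with hv
    have hvk : v κ = ‖w‖⁻¹ • w := by simp [hv]
    have hvl : ∀ i : Fin n, i < κ → v i = b i := by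
      intro i hi; rw [hv, Function.update_of_ne hi.ne]
    have horth : Orthonormal ℝ (({i : Fin n | i ≤ κ} : Set (Fin n)).domRestrict v) := by
      constructor
      · rintro ⟨i, hi⟩
        simp only [Set.domRestrict_apply]
        rcases lt_or_eq_of_le (show i ≤ κ from hi) with h | h
        · rw [hvl i h]; exact b.orthonormal.1 i
        · rw [h, hvk, norm_smul]
          simp
          field_simp
      · rintro ⟨i, hi⟩ ⟨j, hj⟩ hij
        have hij' : i ≠ j := fun h => hij (by simp [h])
        simp only [Set.domRestrict_apply]
        rcases lt_or_eq_of_le (show i ≤ κ from hi) with h | h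
        · rcases lt_or_eq_of_le (show j ≤ κ from hj) with h' | h'
          · rw [hvl i h, hvl j h']; exact b.orthonormal.2 hij'
          · rw [hvl i h, h', hvk, real_inner_smul_right, hbw]
            have : (i : ℕ) < k := h
            simp [this]
        · rcases lt_or_eq_of_le (show j ≤ κ from hj) with h' | h'
          · rw [hvl j h', h, hvk, real_inner_smul_left, real_inner_comm, hbw]
            have : (j : ℕ) < k := h'
            simp [this]
          · exact absurd (h.trans h'.symm) hij'
    obtain ⟨b', hb'⟩ := horth.exists_orthonormalBasis_extension_of_card_eq (by simp)
    have hb'l : ∀ i : Fin n, i < κ → b' i = b i := fun i hi => by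
      rw [hb' i hi.le, hvl i hi]
    have hb'k : b' κ = ‖w‖⁻¹ • w := by rw [hb' κ (by simp), hvk]
    refine ⟨b', Function.update x κ u, ?_⟩
    intro j hj
    rcases Nat.lt_succ_iff_lt_or_eq.1 hj with hj | hj
    · have hjκ : j < κ := hj
      rw [Function.update_of_ne hjκ.ne]
      obtain ⟨h1, h2, h3⟩ := hbx j hj
      refine ⟨h1, ?_, ?_⟩
      · convert h2 using 2
        apply image_congr
        intro i hi
        exact hb'l i (lt_of_le_of_lt hi hjκ)
      · rw [hb'l j hjκ]; exact h3
    · have hjκ : j = κ := Fin.ext hj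
      subst hjκ
      rw [Function.update_self]
      refine ⟨huK, ?_, ?_⟩
      · have hdec : u = (∑ i : Fin n, (if (i : ℕ) < k then ⟪b i, u⟫ else 0) • b i) + w := by
          rw [hw, ← Finset.sum_add_distrib]
          conv_lhs => rw [← b.sum_repr' u]
          congr 1; ext1 i
          split_ifs <;> simp
        rw [hdec]
        apply Submodule.add_mem
        · apply Submodule.sum_mem
          intro i _
          split_ifs with hi
          · apply Submodule.smul_mem
            rw [← hb'l i hi]
            exact Submodule.subset_span ⟨i, le_of_lt (show i < κ from hi), rfl⟩
          · simp
        · have : w = ‖w‖ • b' κ := by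
            rw [hb'k, smul_smul, mul_inv_cancel₀ hwpos.ne', one_smul]
          rw [this]
          apply Submodule.smul_mem
          exact Submodule.subset_span ⟨κ, le_refl κ, rfl⟩
      · rw [hb'k, real_inner_smul_left, hwu]
        have : ‖w‖⁻¹ * ‖w‖ ^ 2 = ‖w‖ := by field_simp
        rw [this]
        exact hwle

lemma prod_bound (hn : 0 < n) {R : ℝ} (hR : 0 ≤ R) :
    (R / 8) ^ n ≤ ∏ j : Fin n, (R / 4 * √((n - j : ℝ) / n)) := by
  rw [Finset.prod_mul_distrib]
  simp only [Finset.prod_const, Finset.card_univ, Fintype.card_fin]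
  have hn' : (0 : ℝ) < n := by exact_mod_cast hn
  have h1 : (1 / 2 : ℝ) ^ n ≤ ∏ j : Fin n, √((n - j : ℝ) / n) := by
    apply (sq_le_sq₀ (by positivity) (by positivity)).1
    rw [← Finset.prod_pow]
    have e1 : ∀ j : Fin n, √((n - j : ℝ) / n) ^ 2 = ((n - (j : ℕ) : ℕ) : ℝ) / n := by
      intro j
      rw [Nat.cast_sub j.2.le, Real.sq_sqrt]
      have : ((j : ℕ) : ℝ) ≤ n := by exact_mod_cast j.2.le
      apply div_nonneg <;> linarith
    simp_rw [e1]
    rw [Fin.prod_univ_eq_prod_range (fun j => ((n - j : ℕ) : ℝ) / n) n, Finset.prod_div_distrib,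
      ← Nat.cast_prod, ← Nat.descFactorial_eq_prod_range, Nat.descFactorial_self]
    simp only [Finset.prod_const, Finset.card_range]
    have h2 := Real.pow_div_factorial_le_exp (x := (n : ℝ)) hn'.le n
    have h3 : Real.exp n ≤ 4 ^ n := by
      have : Real.exp n = Real.exp 1 ^ n := by rw [← Real.exp_nat_mul]; simp
      rw [this]
      have := Real.exp_one_lt_d9
      gcongr
      linarith
    have hf : (0 : ℝ) < n.factorial := by exact_mod_cast n.factorial_pos
    rw [div_le_iff₀ hf] at h2
    rw [le_div_iff₀ (by positivity), ← pow_mul, mul_comm n 2, pow_mul]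
    have h4 : (n : ℝ) ^ n ≤ 4 ^ n * n.factorial := h2.trans (by gcongr)
    calc ((1 / 2 : ℝ) ^ 2) ^ n * (n : ℝ) ^ n ≤ ((1 / 2 : ℝ) ^ 2) ^ n * (4 ^ n * (n.factorial : ℝ)) := by
          gcongr
      _ = (n.factorial : ℝ) := by
          rw [← mul_assoc, ← mul_pow]; norm_num
  calc (R / 8) ^ n = (R / 4) ^ n * (1 / 2) ^ n := by rw [← mul_pow]; ring
    _ ≤ _ := by gcongr

lemma dr_final {K : Set (E n)} (hK : IsConvexBody K) (hL : IsLowner K) (hn : 0 < n)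
    (hd : 0 < Metric.diam K) :
    ∃ (b : OrthonormalBasis (Fin n) ℝ (E n)) (x : Fin n → E n) (A : E n →ₗ[ℝ] E n),
      (∀ j, x j ∈ K) ∧ (∀ j, A (b j) = x j) ∧ (Metric.diam K / 8) ^ n ≤ |LinearMap.det A| := by
  obtain ⟨b, x, h⟩ := dr_induct hK hL hd n le_rfl
  refine ⟨b, x, b.toBasis.constr ℝ x, fun j => (h j j.2).1, fun j => ?_, ?_⟩
  · have := b.toBasis.constr_basis ℝ x j
    rwa [b.coe_toBasis] at this
  · have hM : ∀ i j, LinearMap.toMatrix b.toBasis b.toBasis (b.toBasis.constr ℝ x) i j =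
        ⟪b i, x j⟫ := by
      intro i j
      rw [LinearMap.toMatrix_apply, b.toBasis.constr_basis]
      simp [OrthonormalBasis.repr_apply_apply]
    rw [← LinearMap.det_toMatrix b.toBasis, Matrix.det_of_isUpperTriangular]
    · simp_rw [hM]
      refine le_trans (prod_bound hn hd.le) (le_trans ?_ (le_abs_self _))
      apply Finset.prod_le_prod
      · intro j _; positivity
      · intro j _; exact (h j j.2).2.2
    · intro i j hij
      rw [hM]
      have hs := (h j j.2).2.1
      have : Submodule.span ℝ (b '' {i | i ≤ j}) ≤ (Submodule.span ℝ {b i})ᗮ := by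
        rw [Submodule.span_le]
        rintro _ ⟨l, hl, rfl⟩
        rw [SetLike.mem_coe, Submodule.mem_orthogonal_singleton_iff_inner_right]
        exact b.orthonormal.2 (lt_of_le_of_lt hl hij).ne'
      exact Submodule.mem_orthogonal_singleton_iff_inner_right.1 (this hs)

lemma body_nhds {K : Set (E n)} (hK : IsConvexBody K) : K ∈ nhds (0 : E n) := by
  obtain ⟨hc, hconv, ⟨x, hx⟩, hsym⟩ := hK
  rw [mem_nhds_iff]
  refine ⟨interior K, interior_subset, isOpen_interior, ?_⟩
  have hx' : -x ∈ interior K := by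
    have h1 : interior (-K) = -interior K := by
      have := (Homeomorph.neg (E n)).preimage_interior K
      simpa using this.symm
    rw [hsym, h1]
    simpa using hx
  have := hconv.interior hx hx' (a := 2⁻¹) (b := 2⁻¹) (by norm_num) (by norm_num) (by norm_num)
  simpa using this

lemma body_absorbent {K : Set (E n)} (hK : IsConvexBody K) : Absorbent ℝ K :=
  absorbent_nhds_zero (body_nhds hK)

lemma gauge_le_one_iff' {K : Set (E n)} (hK : IsConvexBody K) (x : E n) :
    gauge K x ≤ 1 ↔ x ∈ K := by
  rw [gauge_le_one_iff_mem_closure hK.2.1 (body_nhds hK), hK.1.isClosed.closure_eq]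

lemma mem_smul_iff_gauge {K : Set (E n)} (hK : IsConvexBody K) {r : ℝ} (hr : 0 < r) (x : E n) :
    x ∈ r • K ↔ gauge K x ≤ r := by
  rw [mem_smul_set_iff_inv_smul_mem₀ hr.ne', ← gauge_le_one_iff' hK,
    gauge_smul_of_nonneg (inv_nonneg.2 hr.le), smul_eq_mul, inv_mul_le_iff₀ hr, mul_one]

lemma body_gauge_neg {K : Set (E n)} (hK : IsConvexBody K) (x : E n) :
    gauge K (-x) = gauge K x := by
  apply gauge_neg
  intro y hy
  rw [hK.2.2.2]; simpa using hy

lemma norm_le_gauge {K : Set (E n)} (hK : IsConvexBody K) (hd : 0 < Metric.diam K) (x : E n) :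
    ‖x‖ ≤ Metric.diam K / 2 * gauge K x := by
  rw [mul_comm, ← div_le_iff₀ (by positivity)]
  apply le_of_forall_gt_imp_ge_of_dense
  intro r hr
  have hr0 : 0 < r := lt_of_le_of_lt (gauge_nonneg x) hr
  have h1 := (mem_smul_iff_gauge hK hr0 x).2 hr.le
  obtain ⟨y, hy, rfl⟩ := h1
  have := norm_le_half_diam hK hy
  rw [div_le_iff₀ (by positivity), norm_smul, Real.norm_of_nonneg hr0.le]
  gcongr

lemma diam_pos {K : Set (E n)} (hK : IsConvexBody K) (hn : 0 < n) : 0 < Metric.diam K := by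
  obtain ⟨δ, hδ, hb⟩ := Metric.mem_nhds_iff.1 (body_nhds hK)
  have h1 : (δ / 2) • (EuclideanSpace.basisFun (Fin n) ℝ ⟨0, hn⟩) ∈ K := by
    apply hb
    rw [mem_ball_zero_iff, norm_smul, (EuclideanSpace.basisFun (Fin n) ℝ).orthonormal.1,
      Real.norm_of_nonneg (by positivity)]
    linarith
  have h2 := norm_le_half_diam hK h1
  rw [norm_smul, (EuclideanSpace.basisFun (Fin n) ℝ).orthonormal.1,
      Real.norm_of_nonneg (by positivity)] at h2
  linarith

lemma modConv_le {K : Set (E n)} (hK : IsConvexBody K) {ε : ℝ} {x y : E n} (hx : x ∈ K)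
    (hy : y ∈ K) (hxy : ε ≤ gauge K (x - y)) :
    modConv K ε ≤ 1 - gauge K ((2⁻¹ : ℝ) • (x + y)) := by
  apply csInf_le
  · refine ⟨0, ?_⟩
    rintro d ⟨x, y, hx, hy, -, rfl⟩
    have h1 := gauge_add_le hK.2.1 (body_absorbent hK) x y
    rw [gauge_smul_of_nonneg (by norm_num), smul_eq_mul]
    linarith
  · exact ⟨x, y, (gauge_le_one_iff' hK x).2 hx, (gauge_le_one_iff' hK y).2 hy, hxy, rfl⟩

lemma one_le_p {K : Set (E n)} {p α : ℝ} (hα : 0 < α) (h : IsPConvexBody K p α) (hn : 0 < n) :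
    1 ≤ p := by
  obtain ⟨hK, hmod⟩ := h
  by_contra hp
  push Not at hp
  have hd := diam_pos hK hn
  set e := EuclideanSpace.basisFun (Fin n) ℝ ⟨0, hn⟩ with he
  have hen : ‖e‖ = 1 := (EuclideanSpace.basisFun (Fin n) ℝ).orthonormal.1 _
  have hg : 0 < gauge K e := by
    have := norm_le_gauge hK hd e
    rw [hen] at this
    by_contra h0
    have h1 : gauge K e = 0 := le_antisymm (not_lt.1 h0) (gauge_nonneg e)
    rw [h1] at this
    linarith
  set x := (gauge K e)⁻¹ • e with hx
  have hgx : gauge K x = 1 := by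
    rw [hx, gauge_smul_of_nonneg (inv_nonneg.2 hg.le), smul_eq_mul, inv_mul_cancel₀ hg.ne']
  set ε := min 1 (α ^ (1 / (1 - p))) with hε
  have hε0 : 0 < ε := by
    apply lt_min one_pos
    positivity
  have hε1 : ε ≤ 1 := min_le_left _ _
  have h1 := hmod ε hε0 (by linarith)
  have h2 := modConv_le hK (ε := ε) (x := x) (y := (1 - ε) • x)
    ((gauge_le_one_iff' hK x).1 hgx.le)
    ((gauge_le_one_iff' hK _).1 (by
      rw [gauge_smul_of_nonneg (by linarith), hgx, smul_eq_mul]; linarith))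
    (by
      have : x - (1 - ε) • x = ε • x := by module
      rw [this, gauge_smul_of_nonneg hε0.le, hgx, smul_eq_mul, mul_one])
  have e1 : (2⁻¹ : ℝ) • (x + (1 - ε) • x) = (1 - ε / 2) • x := by module
  rw [e1, gauge_smul_of_nonneg (by linarith), hgx, smul_eq_mul, mul_one] at h2
  have h3 : ε ^ (1 - p) ≤ α := by
    calc ε ^ (1 - p) ≤ (α ^ (1 / (1 - p))) ^ (1 - p) :=
          Real.rpow_le_rpow hε0.le (min_le_right _ _) (by linarith)
      _ = α := by
          rw [← Real.rpow_mul hα.le, one_div_mul_cancel (by linarith), Real.rpow_one]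
  have h4 : ε = ε ^ p * ε ^ (1 - p) := by
    rw [← Real.rpow_add hε0]; simp
  have h5 : 0 < ε ^ p := by positivity
  nlinarith

lemma prod_conc {K : Set (E n)} {p α : ℝ} (hα : 0 < α) (h : IsPConvexBody K p α) (hn : 0 < n)
    (hvol : volume K = 1) (a b : ℝ) (hab : a < b) :
    (volume.restrict K) {x : E n | ‖x‖ / √n ≤ a} * (volume.restrict K) {x : E n | b ≤ ‖x‖ / √n} ≤
      ENNReal.ofReal (Real.exp (-(2 * n * α *
        ((b - a) * (√n / (Metric.diam K / 2))) ^ p))) := by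
  obtain ⟨hK, hmod⟩ := h
  have hd := diam_pos hK hn
  have hn' : (0 : ℝ) < n := by exact_mod_cast hn
  have hsn : 0 < √(n : ℝ) := Real.sqrt_pos.2 hn'
  have mA : MeasurableSet {x : E n | ‖x‖ / √n ≤ a} :=
    measurableSet_le (by fun_prop) measurable_const
  have mB : MeasurableSet {x : E n | b ≤ ‖x‖ / √n} :=
    measurableSet_le measurable_const (by fun_prop)
  rw [Measure.restrict_apply mA, Measure.restrict_apply mB]
  set A := {x : E n | ‖x‖ / √n ≤ a} ∩ K with hA
  set B := {x : E n | b ≤ ‖x‖ / √n} ∩ K with hB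
  set ε := (b - a) * (√n / (Metric.diam K / 2)) with hε
  have hε0 : 0 < ε := by
    have : 0 < b - a := by linarith
    positivity
  have hKm := hK.1.measurableSet
  rcases A.eq_empty_or_nonempty with hAe | ⟨x0, hx0⟩
  · simp [hAe]
  rcases B.eq_empty_or_nonempty with hBe | ⟨y0, hy0⟩
  · simp [hBe]
  have hdist : ∀ x ∈ A, ∀ y ∈ B, ε ≤ gauge K (x - y) := by
    intro x hx y hy
    have h1 := norm_le_gauge hK hd (x - y)
    have h2 : ‖x‖ ≤ a * √n := (div_le_iff₀ hsn).1 hx.1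
    have h3 : b * √n ≤ ‖y‖ := (le_div_iff₀ hsn).1 hy.1
    have h4 := norm_sub_norm_le y x
    rw [norm_sub_rev] at h4
    rw [hε, ← mul_div_assoc, div_le_iff₀ (by positivity)]
    linarith
  have hε2 : ε ≤ 2 := by
    have h1 := hdist x0 hx0 y0 hy0
    have h2 := gauge_add_le hK.2.1 (body_absorbent hK) x0 (-y0)
    rw [body_gauge_neg hK, ← sub_eq_add_neg] at h2
    have h3 := (gauge_le_one_iff' hK x0).2 hx0.2
    have h4 := (gauge_le_one_iff' hK y0).2 hy0.2
    linarith
  have hm := hmod ε hε0 hε2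
  set δ := α * ε ^ p with hδ
  have hbm := bm_E (A := A) (B := B) (C := Real.exp (-δ) • K) (mA.inter hKm) (mB.inter hKm)
    (hK.1.smul _).measurableSet (by
      intro x hx y hy
      rw [mem_smul_iff_gauge hK (Real.exp_pos _)]
      have h1 := modConv_le hK hx.2 hy.2 (hdist x hx y hy)
      have h2 := Real.add_one_le_exp (-δ)
      linarith)
  refine hbm.trans (le_of_eq ?_)
  rw [Measure.addHaar_smul_of_nonneg _ (Real.exp_pos _).le, hvol, mul_one,
    ← ENNReal.ofReal_pow (by positivity), finrank_euclideanSpace_fin, ← Real.exp_nat_mul,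
    ← Real.exp_nat_mul, hδ]
  congr 2
  push_cast
  ring

lemma type_bound {K : Set (E n)} (hK : IsConvexBody K) (hL : IsLowner K) (hn : 0 < n)
    (hvol : volume K = 1) {s T : ℝ} (hs : 1 ≤ s) (hT : 0 < T)
    (h : ∀ m : ℕ, ∀ x : Fin m → E n,
      Real.sqrt (((2 : ℝ) ^ m)⁻¹ * ∑ ε : Fin m → Bool,
        gauge K (∑ i, (if ε i then (1 : ℝ) else -1) • x i) ^ 2) ≤
        T * (∑ i, gauge K (x i) ^ s) ^ (1 / s)) :
    Metric.diam K / 2 ≤ 8 * (T * (n : ℝ) ^ (1 / s)) := by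
  have hd := diam_pos hK hn
  have hn' : (0 : ℝ) < n := by exact_mod_cast hn
  obtain ⟨b, x, A, hxK, hA, hdet⟩ := dr_final hK hL hn hd
  set r := T * (n : ℝ) ^ (1 / s) with hr
  have hr0 : 0 < r := by positivity
  have hdet0 : 0 < |LinearMap.det A| := lt_of_lt_of_le (by positivity) hdet
  set sg : (Fin n → Bool) → Fin n → ℝ := fun ε i => if ε i then (1 : ℝ) else -1 with hsg
  set S := A ⁻¹' (r • K) with hS
  have hcover : parallelepiped b ⊆ ⋃ ε : Fin n → Bool, (diagMap b (sg ε)) ⁻¹' S := by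
    intro z hz
    rw [mem_parallelepiped_iff] at hz
    obtain ⟨t, ht, rfl⟩ := hz
    have hty := h n (fun i => t i • x i)
    have h1 : T * (∑ i, gauge K (t i • x i) ^ s) ^ (1 / s) ≤ r := by
      rw [hr]
      gcongr
      · exact Finset.sum_nonneg fun i _ => Real.rpow_nonneg (gauge_nonneg _) _
      · calc ∑ i, gauge K (t i • x i) ^ s ≤ ∑ i : Fin n, (1 : ℝ) := by
              apply Finset.sum_le_sum
              intro i _
              apply Real.rpow_le_one (gauge_nonneg _) _ (by linarith)
              rw [gauge_smul_of_nonneg (ht.1 i), smul_eq_mul]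
              have h2 := (gauge_le_one_iff' hK (x i)).2 (hxK i)
              have h3 : t i ≤ 1 := ht.2 i
              exact mul_le_one₀ h3 (gauge_nonneg _) h2
          _ = n := by simp
    have h2 := hty.trans h1
    rw [Real.sqrt_le_left hr0.le, inv_mul_le_iff₀ (by positivity)] at h2
    have h3 : ∃ ε : Fin n → Bool, gauge K (∑ i, sg ε i • t i • x i) ^ 2 ≤ r ^ 2 := by
      by_contra hcon
      push Not at hcon
      have h4 : ∑ ε : Fin n → Bool, r ^ 2 <
          ∑ ε : Fin n → Bool, gauge K (∑ i, sg ε i • t i • x i) ^ 2 :=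
        Finset.sum_lt_sum_of_nonempty Finset.univ_nonempty fun ε _ => hcon ε
      simp only [Finset.sum_const, Finset.card_univ, Fintype.card_pi, Fintype.card_bool,
        Finset.prod_const, Fintype.card_fin, nsmul_eq_mul] at h4
      push_cast at h4
      exact absurd h2 (not_le.2 h4)
    obtain ⟨ε, hε⟩ := h3
    have h5 := (sq_le_sq₀ (gauge_nonneg _) hr0.le).1 hε
    rw [mem_iUnion]
    refine ⟨ε, ?_⟩
    rw [mem_preimage, hS, mem_preimage, mem_smul_iff_gauge hK hr0]
    have e0 : A (diagMap b (sg ε) (∑ i, t i • b i)) = ∑ i, sg ε i • t i • x i := by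
      rw [map_sum, map_sum]
      refine Finset.sum_congr rfl fun i _ => ?_
      rw [map_smul, map_smul, diagMap_apply_basis, map_smul, hA, smul_comm]
    rw [e0]
    exact h5
  have hdiag : ∀ ε, |LinearMap.det (diagMap b (sg ε))| = 1 := by
    intro ε
    rw [diagMap_det, Finset.abs_prod]
    apply Finset.prod_eq_one
    intro i _
    simp only [hsg]
    split_ifs <;> simp
  have hv1 : (1 : ℝ≥0∞) ≤ 2 ^ n * volume S := by
    rw [← b.volume_parallelepiped]
    refine (measure_mono hcover).trans ((measure_iUnion_le _).trans ?_)
    rw [tsum_fintype]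
    have : ∀ ε, volume ((diagMap b (sg ε)) ⁻¹' S) = volume S := by
      intro ε
      rw [Measure.addHaar_preimage_linearMap, abs_inv, hdiag]
      · simp
      · intro h0
        have := hdiag ε
        rw [h0] at this
        simp at this
    simp [this]
  rw [hS, Measure.addHaar_preimage_linearMap _ (abs_pos.1 hdet0),
    Measure.addHaar_smul_of_nonneg _ hr0.le, hvol, mul_one, finrank_euclideanSpace_fin,
    ← ENNReal.ofReal_mul (by positivity)] at hv1
  have e2 : (2 : ℝ≥0∞) ^ n = ENNReal.ofReal (2 ^ n) := by
    rw [ENNReal.ofReal_pow (by norm_num)]; simp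
  rw [e2, ← ENNReal.ofReal_mul (by positivity), ENNReal.one_le_ofReal, abs_inv] at hv1
  have hv2 : |LinearMap.det A| ≤ (2 * r) ^ n := by
    have : (2 : ℝ) ^ n * (|LinearMap.det A|⁻¹ * r ^ n) = (2 * r) ^ n / |LinearMap.det A| := by
      have g : ∀ q d : ℝ, (2 : ℝ) ^ n * (d⁻¹ * q ^ n) = (2 * q) ^ n / d := by
        intro q d
        rw [mul_pow, div_eq_mul_inv]; ring
      exact g r _
    rw [this, le_div_iff₀ hdet0] at hv1
    linarith
  have h6 : Metric.diam K / 8 ≤ 2 * r :=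
    le_of_pow_le_pow_left₀ hn.ne' (by positivity) (hdet.trans hv2)
  linarith

/-- concentration for `p`-convex bodies in Löwner position. -/
theorem p_convex_lowner_shell_concentration :
    ∃ c > (0 : ℝ),
      ∀ (n : ℕ) (K : Set (E n)) (p α : ℝ), 0 < α →
        IsPConvexBody K p α → volume K = 1 → IsLowner K →
        ∀ ρ : ℝ, ρ = (∫ x in K, ‖x‖) / Real.sqrt n →
          ∀ s : ℝ, 1 ≤ s → s ≤ 2 → ∀ t : ℝ, 0 < t →
            volume {x : E n | x ∈ K ∧ t ≤ |‖x‖ / Real.sqrt n - ρ|} ≤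
              ENNReal.ofReal (4 * Real.exp (-(2 * c ^ p * α *
                (n : ℝ) ^ (1 + p / 2 - p / s) * (t / typeConst K s) ^ p))) := by
  refine ⟨1 / 320, by norm_num, ?_⟩
  intro n K p α hα hKp hvol hLow ρ hρ s hs1 hs2 t ht
  rcases Nat.eq_zero_or_pos n with hn | hn
  · subst hn
    have : {x : E 0 | x ∈ K ∧ t ≤ |‖x‖ / Real.sqrt (0 : ℕ) - ρ|} = ∅ := by
      ext x
      simp [hρ, ht]
    rw [this]
    simp
  have hK := hKp.1
  have hp := one_le_p hα hKp hn
  have hd := diam_pos hK hn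
  have hn' : (0 : ℝ) < n := by exact_mod_cast hn
  have hsn : 0 < √(n : ℝ) := Real.sqrt_pos.2 hn'
  by_cases hT0 : typeConst K s = 0
  · rw [hT0, div_zero, Real.zero_rpow (by linarith)]
    calc _ ≤ volume K := measure_mono fun x hx => hx.1
      _ = ENNReal.ofReal 1 := by rw [hvol]; simp
      _ ≤ _ := by
        apply ENNReal.ofReal_le_ofReal
        simp
  set R := Metric.diam K / 2 with hR
  have hR0 : 0 < R := by positivity
  set ns := (n : ℝ) ^ (1 / s) with hns
  have hns0 : 0 < ns := by positivity
  have hTR : R / (8 * ns) ≤ typeConst K s := by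
    unfold typeConst
    apply le_csInf
    · by_contra hne
      rw [not_nonempty_iff_eq_empty] at hne
      apply hT0
      unfold typeConst
      rw [hne, Real.sInf_empty]
    · rintro T ⟨hT, hty⟩
      have := type_bound hK hLow hn hvol hs1 hT hty
      rw [div_le_iff₀ (by positivity)]
      linarith
  set T := typeConst K s with hT
  have hTpos : 0 < T := lt_of_lt_of_le (by positivity) hTR
  have hRT : R ≤ T * (8 * ns) := (div_le_iff₀ (by positivity)).1 hTR
  haveI : IsProbabilityMeasure (volume.restrict K : Measure (E n)) := ⟨by simp [hvol]⟩
  set L := (2 * n * α) ^ (1 / p) * (√n / R) with hL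
  have hL0 : 0 < L := by positivity
  have hLp : ∀ u, 0 ≤ u → (L * u) ^ p = 2 * n * α * (u * (√n / R)) ^ p := by
    intro u hu
    have e1 : L * u = (2 * n * α) ^ (1 / p) * (u * (√n / R)) := by rw [hL]; ring
    rw [e1, Real.mul_rpow (by positivity) (by positivity), ← Real.rpow_mul (by positivity),
      one_div_mul_cancel (by linarith), Real.rpow_one]
  have hfm : Measurable fun x : E n => ‖x‖ / √n := by fun_prop
  have hfi : Integrable (fun x : E n => ‖x‖ / √n) (volume.restrict K) := by
    apply ContinuousOn.integrableOn_compact hK.1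
    fun_prop
  have key := conc_two (volume.restrict K) hfm hfi hL0 hp (by
    intro a b hab
    rw [hLp _ (by linarith)]
    exact prod_conc hα hKp hn hvol a b hab) ht
  rw [integral_div, ← hρ, Measure.restrict_apply
    (measurableSet_le measurable_const (by fun_prop))] at key
  have hset : {x : E n | x ∈ K ∧ t ≤ |‖x‖ / Real.sqrt n - ρ|} =
      {x : E n | t ≤ |‖x‖ / √n - ρ|} ∩ K := by
    ext x
    simp only [mem_ofPred_eq, mem_inter_iff]
    tauto
  rw [hset]
  refine key.trans (ENNReal.ofReal_le_ofReal ?_)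
  gcongr
  rw [mul_div_assoc, hLp _ (by positivity)]
  have e1 : (n : ℝ) ^ (1 + p / 2 - p / s) = n * (√n / ns) ^ p := by
    rw [hns, Real.sqrt_eq_rpow, ← Real.rpow_sub hn', ← Real.rpow_mul hn'.le]
    have e4 : 1 + p / 2 - p / s = 1 + (1 / 2 - 1 / s) * p := by ring
    rw [e4, Real.rpow_add hn', Real.rpow_one]
  have e2 : 2 * (1 / 320) ^ p * α * (n : ℝ) ^ (1 + p / 2 - p / s) * (t / T) ^ p =
      2 * n * α * (1 / 320 * (√n / ns) * (t / T)) ^ p := by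
    rw [e1, Real.mul_rpow (by positivity) (by positivity),
      Real.mul_rpow (by positivity) (by positivity)]
    ring
  have e3 : 1 / 320 * (√n / ns) * (t / T) = t / 40 * (√n / (T * (8 * ns))) := by
    field_simp
    norm_num
  rw [e2, e3]
  apply mul_le_mul_of_nonneg_left _ (by positivity)
  apply Real.rpow_le_rpow (by positivity) _ (by linarith)
  gcongr

end GM
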